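/- arXiv:2204.06349 — 6 statements merged into one kernel-verified Lean document; each statement's English description precedes it below -/
import Mathlib

section
/- Let σ ∈ ℕ with σ ≥ 1. For every x ∈ ℝ, the mixed uniform-logarithmic quantizer Q satisfies the sector bound (1 − 0.5/10^(σ−1))·x² ≤ x·Q(x) ≤ (1 + 0.5/10^(σ−1))·x². -/
/-- Base-10 scaling factor of the mixed uniform-logarithmic quantizer (MULQ):
`S(x) = 10^(σ - ⌊log₁₀ |x|⌋ - 1)`. -/
noncomputable def mulqS (σ : ℕ) (x : ℝ) : ℝ :=
  (10 : ℝ) ^ ((σ : ℤ) - ⌊Real.logb 10 |x|⌋ - 1)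

/-- The mixed uniform-logarithmic quantizer: `Q(x) = (1/S(x)) ⬝ round (S(x)·x)`, `Q(0) = 0`. -/
noncomputable def mulqQ (σ : ℕ) (x : ℝ) : ℝ :=
  if x = 0 then 0 else (round (mulqS σ x * x) : ℤ) / mulqS σ x

theorem mulqS_pos (σ : ℕ) (x : ℝ) : 0 < mulqS σ x := by
  unfold mulqS
  positivity

/-- The scaled input `S(x)·x` has at least `σ` digits before the decimal point. -/
theorem pow_le_mulqS_mul_abs {σ : ℕ} (hσ : 1 ≤ σ) {x : ℝ} (hx : x ≠ 0) :
    (10 : ℝ) ^ (σ - 1) ≤ mulqS σ x * |x| := by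
  have hfloor : (10 : ℝ) ^ ⌊Real.logb 10 |x|⌋ ≤ |x| := by
    rw [← Real.rpow_intCast, ← Real.le_logb_iff_rpow_le (by norm_num) (abs_pos.mpr hx)]
    exact Int.floor_le _
  calc (10 : ℝ) ^ (σ - 1) = mulqS σ x * 10 ^ ⌊Real.logb 10 |x|⌋ := by
        rw [mulqS, ← zpow_add₀ (by norm_num), ← zpow_natCast]
        congr 1
        omega
    _ ≤ mulqS σ x * |x| := mul_le_mul_of_nonneg_left hfloor (mulqS_pos σ x).le

/-- The relative quantization error is at most `0.5 / 10^(σ - 1)`. -/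
theorem abs_mulqQ_sub_le {σ : ℕ} (hσ : 1 ≤ σ) (x : ℝ) :
    |mulqQ σ x - x| ≤ 0.5 / 10 ^ (σ - 1) * |x| := by
  by_cases hx : x = 0
  · simp [mulqQ, hx]
  have hS := mulqS_pos σ x
  have hround := abs_sub_round (mulqS σ x * x)
  rw [abs_sub_comm] at hround
  have herr : mulqQ σ x - x = (round (mulqS σ x * x) - mulqS σ x * x) / mulqS σ x := by
    rw [mulqQ, if_neg hx]
    field_simp
  rw [herr, abs_div, abs_of_pos hS, div_mul_eq_mul_div, div_le_div_iff₀ hS (by positivity)]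
  calc |round (mulqS σ x * x) - mulqS σ x * x| * 10 ^ (σ - 1)
      ≤ 1 / 2 * (mulqS σ x * |x|) :=
        mul_le_mul hround (pow_le_mulqS_mul_abs hσ hx) (by positivity) (by norm_num)
    _ = 0.5 * |x| * mulqS σ x := by ring

/-- Sector bound (A1): `(1 − 0.5/10^(σ−1))·x² ≤ x·Q(x) ≤ (1 + 0.5/10^(σ−1))·x²`. -/
theorem mulq_sector_bound (σ : ℕ) (hσ : 1 ≤ σ) (x : ℝ) :
    (1 - 0.5 / 10 ^ (σ - 1)) * |x| ^ 2 ≤ x * mulqQ σ x ∧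
      x * mulqQ σ x ≤ (1 + 0.5 / 10 ^ (σ - 1)) * |x| ^ 2 := by
  have herr : |x * mulqQ σ x - |x| ^ 2| ≤ 0.5 / 10 ^ (σ - 1) * |x| ^ 2 := by
    calc |x * mulqQ σ x - |x| ^ 2| = |x| * |mulqQ σ x - x| := by
          rw [sq_abs, ← abs_mul]
          ring_nf
      _ ≤ |x| * (0.5 / 10 ^ (σ - 1) * |x|) :=
          mul_le_mul_of_nonneg_left (abs_mulqQ_sub_le hσ x) (abs_nonneg x)
      _ = 0.5 / 10 ^ (σ - 1) * |x| ^ 2 := by ring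
  rw [sub_mul, add_mul, one_mul]
  constructor <;> linarith [abs_le.mp herr]
end

section
/- Let σ ∈ ℕ with σ ≥ 1. For every x ∈ ℝ, the mixed uniform-logarithmic quantizer Q satisfies |x − Q(x)| ≤ (0.5/10^(σ−1))·|x|. -/
theorem abs_sub_mulqQ_le (σ : ℕ) {x : ℝ} (hx : x ≠ 0) :
    |x - mulqQ σ x| ≤ 1 / 2 / mulqS σ x := by
  have hS := mulqS_pos σ x
  have h : x - mulqQ σ x = (mulqS σ x * x - round (mulqS σ x * x)) / mulqS σ x := by
    rw [mulqQ, if_neg hx, sub_div, mul_div_cancel_left₀ _ hS.ne']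
  rw [h, abs_div, abs_of_pos hS]
  exact div_le_div_of_nonneg_right (abs_sub_round _) hS.le

/-- Sector bound (A2): `|x − Q(x)| ≤ (0.5/10^(σ−1))·|x|`. -/
theorem mulq_error_bound (σ : ℕ) (hσ : 1 ≤ σ) (x : ℝ) :
    |x - mulqQ σ x| ≤ 0.5 / 10 ^ (σ - 1) * |x| := by
  rcases eq_or_ne x 0 with rfl | hx
  · simp [mulqQ]
  · refine (abs_sub_mulqQ_le σ hx).trans ?_
    rw [div_mul_eq_mul_div, div_le_div_iff₀ (mulqS_pos σ x) (by positivity)]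
    linarith [pow_le_mulqS_mul_abs hσ hx]
end

section
/- Let σ ∈ ℕ with σ ≥ 1. For every x ∈ ℝ with x ≠ 0, the quantity S(x)·Q(x) equals the rounding ⟨S(x)·x⟩, hence it is an integer, and it satisfies |S(x)·Q(x)| ≤ 10^σ; consequently the quantized sensor data can always be represented in a fixed bounded integer plaintext set independent of the magnitude of x. -/
theorem abs_mulqS_mul_lt (σ : ℕ) {x : ℝ} (hx : x ≠ 0) : |mulqS σ x * x| < 10 ^ σ := by
  have hlt : |x| < (10 : ℝ) ^ (⌊Real.logb 10 |x|⌋ + 1) := by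
    rw [← Real.rpow_intCast, ← Real.logb_lt_iff_lt_rpow (by norm_num) (abs_pos.mpr hx)]
    push_cast
    exact Int.lt_floor_add_one _
  calc |mulqS σ x * x| = mulqS σ x * |x| := by rw [abs_mul, abs_of_pos (mulqS_pos σ x)]
    _ < mulqS σ x * (10 : ℝ) ^ (⌊Real.logb 10 |x|⌋ + 1) :=
      mul_lt_mul_of_pos_left hlt (mulqS_pos σ x)
    _ = 10 ^ σ := by
      rw [mulqS, ← zpow_add₀ (by norm_num), ← zpow_natCast]
      congr 1
      ring

theorem abs_round_le_of_abs_le {y : ℝ} {n : ℤ} (h : |y| ≤ n) : |round y| ≤ n := by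
  obtain ⟨hl, hu⟩ := abs_le.mp h
  obtain ⟨hl', hu'⟩ := abs_le.mp (abs_sub_round y)
  have h₁ : ((round y : ℤ) : ℝ) < ((n + 1 : ℤ) : ℝ) := by push_cast; linarith
  have h₂ : ((-n - 1 : ℤ) : ℝ) < ((round y : ℤ) : ℝ) := by push_cast; linarith
  rw [Int.cast_lt] at h₁ h₂
  exact abs_le.mpr ⟨by lia, by lia⟩

/-- `S(x)·Q(x)` equals the rounded value `⟨S(x)·x⟩`, hence is an integer, and it is bounded
in absolute value by `10^σ`: the quantized data fits in a fixed bounded integer plaintext set. -/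
theorem mulq_plaintext_bound (σ : ℕ) (hσ : 1 ≤ σ) (x : ℝ) (hx : x ≠ 0) :
    mulqS σ x * mulqQ σ x = (round (mulqS σ x * x) : ℤ) ∧
      (∃ z : ℤ, mulqS σ x * mulqQ σ x = (z : ℝ)) ∧
      |mulqS σ x * mulqQ σ x| ≤ 10 ^ σ := by
  have heq : mulqS σ x * mulqQ σ x = (round (mulqS σ x * x) : ℤ) := by
    rw [mulqQ, if_neg hx, mul_div_cancel₀ _ (mulqS_pos σ x).ne']
  refine ⟨heq, ⟨_, heq⟩, ?_⟩
  rw [heq]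
  have h : |round (mulqS σ x * x)| ≤ (10 : ℤ) ^ σ :=
    abs_round_le_of_abs_le (by exact_mod_cast (abs_mulqS_mul_lt σ hx).le)
  exact_mod_cast h
end

section
/- (Correctness of FHE-LWE decryption.) Let w, a, N be positive integers, q = w·a, and let s ∈ (ZMod q)^N be a secret key with s̄ = (1, s) ∈ (ZMod q)^(N+1). Let m, e ∈ ℤ with 2·|e| < w and 2·|w·m + e| < q, and let c ∈ (ZMod q)^(N+1) be any ciphertext of m with injected error e, i.e. ⟨c, s̄⟩ = (w·m + e : ℤ) in ZMod q (the LWE encryption c = ((−⟨A', s⟩ + w·m + e) mod q, A') has this property for any A' ∈ (ZMod q)^N). Then Dec(c) := ⌈ valMinAbs(⟨c, s̄⟩) / w ⌋ = m. -/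
open Matrix

/-- FHE-LWE decryption: `Dec(c) = ⌈ valMinAbs(⟨c, s̄⟩) / w ⌋`. -/
noncomputable def lweDec (w q : ℕ) {N : ℕ} (s : Fin N → ZMod q) (c : Fin (N + 1) → ZMod q) : ℤ :=
  round (((c ⬝ᵥ Fin.cons 1 s).valMinAbs : ℚ) / (w : ℚ))

/-- Correctness of FHE-LWE decryption: any ciphertext `c` of the message `m` with injected
error `e` (i.e. `⟨c, s̄⟩ = w·m + e` in `ZMod (w·a)`), with `2|e| < w` and `2|w·m + e| < w·a`,
decrypts to `m`. -/
theorem lwe_dec_correct (w a N : ℕ) (hw : 0 < w) (ha : 0 < a) (hN : 0 < N)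
    (s : Fin N → ZMod (w * a)) (m e : ℤ)
    (he : 2 * |e| < (w : ℤ)) (hme : 2 * |(w : ℤ) * m + e| < (w : ℤ) * (a : ℤ))
    (c : Fin (N + 1) → ZMod (w * a))
    (hc : c ⬝ᵥ Fin.cons 1 s = (((w : ℤ) * m + e : ℤ) : ZMod (w * a))) :
    lweDec w (w * a) s c = m := by
  have : NeZero (w * a) := ⟨(Nat.mul_pos hw ha).ne'⟩
  have hv : (c ⬝ᵥ Fin.cons 1 s).valMinAbs = (w : ℤ) * m + e := by
    rw [ZMod.valMinAbs_spec]
    have h₁ := neg_abs_le ((w : ℤ) * m + e)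
    have h₂ := le_abs_self ((w : ℤ) * m + e)
    refine ⟨hc, ?_, ?_⟩ <;> push_cast <;> linarith
  have hw' : (0 : ℚ) < w := by exact_mod_cast hw
  have he' : 2 * |(e : ℚ)| < w := by exact_mod_cast he
  have h₁ := neg_abs_le (e : ℚ)
  have h₂ := le_abs_self (e : ℚ)
  rw [lweDec, hv, round_eq, Int.floor_eq_iff]
  push_cast
  rw [add_div, mul_div_cancel_left₀ _ hw'.ne']
  have h₃ : -(1 / 2) < (e : ℚ) / w := by rw [lt_div_iff₀ hw']; linarith
  have h₄ : (e : ℚ) / w < 1 / 2 := by rw [div_lt_iff₀ hw']; linarith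
  constructor <;> linarith
end

section
/- (Additive homomorphism of FHE-LWE.) Let w, a, N be positive integers, q = w·a, s ∈ (ZMod q)^N a secret key with s̄ = (1, s). Let m₁, m₂, e₁, e₂ ∈ ℤ and let c₁, c₂ ∈ (ZMod q)^(N+1) satisfy ⟨c₁, s̄⟩ = (w·m₁ + e₁ : ℤ) and ⟨c₂, s̄⟩ = (w·m₂ + e₂ : ℤ) in ZMod q. If 2·|e₁ + e₂| < w and 2·|w·(m₁ + m₂) + e₁ + e₂| < q, then Dec(c₁ + c₂) := ⌈ valMinAbs(⟨c₁ + c₂, s̄⟩) / w ⌋ = m₁ + m₂. -/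
open Matrix

/-- Additive homomorphism of FHE-LWE: if `c₁, c₂` are ciphertexts of `m₁, m₂` with injected
errors `e₁, e₂` and `2|e₁ + e₂| < w`, `2|w(m₁+m₂) + e₁ + e₂| < w·a`, then `c₁ + c₂` decrypts
to `m₁ + m₂`. -/
theorem lwe_add_homomorphic (w a N : ℕ) (hw : 0 < w) (ha : 0 < a) (hN : 0 < N)
    (s : Fin N → ZMod (w * a)) (m₁ m₂ e₁ e₂ : ℤ)
    (c₁ c₂ : Fin (N + 1) → ZMod (w * a))
    (hc₁ : c₁ ⬝ᵥ Fin.cons 1 s = (((w : ℤ) * m₁ + e₁ : ℤ) : ZMod (w * a)))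
    (hc₂ : c₂ ⬝ᵥ Fin.cons 1 s = (((w : ℤ) * m₂ + e₂ : ℤ) : ZMod (w * a)))
    (he : 2 * |e₁ + e₂| < (w : ℤ))
    (hme : 2 * |(w : ℤ) * (m₁ + m₂) + e₁ + e₂| < (w : ℤ) * (a : ℤ)) :
    lweDec w (w * a) s (c₁ + c₂) = m₁ + m₂ := by
  have : NeZero (w * a) := ⟨(Nat.mul_pos hw ha).ne'⟩
  have hsum : (c₁ + c₂) ⬝ᵥ Fin.cons 1 s =
      (((w : ℤ) * (m₁ + m₂) + e₁ + e₂ : ℤ) : ZMod (w * a)) := by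
    rw [add_dotProduct, hc₁, hc₂]
    push_cast
    ring
  have hval : ((c₁ + c₂) ⬝ᵥ Fin.cons 1 s).valMinAbs = (w : ℤ) * (m₁ + m₂) + e₁ + e₂ := by
    rw [ZMod.valMinAbs_spec]
    refine ⟨hsum, ?_, ?_⟩ <;> push_cast <;>
      linarith [neg_abs_le ((w : ℤ) * (m₁ + m₂) + e₁ + e₂),
        le_abs_self ((w : ℤ) * (m₁ + m₂) + e₁ + e₂)]
  have hwQ : (0 : ℚ) < w := by exact_mod_cast hw
  have hlo : (-w : ℚ) < 2 * (e₁ + e₂) := by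
    exact_mod_cast (by linarith [neg_abs_le (e₁ + e₂)] : -(w : ℤ) < 2 * (e₁ + e₂))
  have hhi : (2 * (e₁ + e₂) : ℚ) < w := by
    exact_mod_cast (by linarith [le_abs_self (e₁ + e₂)] : 2 * (e₁ + e₂) < (w : ℤ))
  rw [lweDec, hval, round_eq_iff, Set.mem_Ico, le_div_iff₀ hwQ, div_lt_iff₀ hwQ]
  push_cast
  constructor <;> linarith
end

section
/- (Multiplicative homomorphism of FHE-LWE.) Let w, a, N, L be positive integers with q = w·a = 10^L and s ∈ (ZMod q)^N a secret key with s̄ = (1, s) ∈ (ZMod q)^(N+1). Let R be the L·(N+1) × (N+1) matrix over ZMod q given by R_{(i,j),j'} = 10^i if j = j' and 0 otherwise (i.e. col(10⁰, …, 10^(L−1)) ⊗ I_(N+1)). Let m₁, m₂, e₂ ∈ ℤ and ε₁ ∈ ℤ^(L·(N+1)), and suppose: (i) M₁ is an L·(N+1) × (N+1) matrix over ZMod q with M₁·s̄ = m₁·(R·s̄) + ε₁ (componentwise, with ε₁ cast to ZMod q) — an Enc2-ciphertext of m₁; (ii) c₂ ∈ (ZMod q)^(N+1) satisfies ⟨c₂,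 s̄⟩ = (w·m₂ + e₂ : ℤ) — an Enc-ciphertext of m₂; (iii) D₂ ∈ ℤ^(L·(N+1)) has all entries in {0, …, 9} and its cast to ZMod q satisfies D₂ᵀ·R = c₂ (a base-10 digit decomposition of c₂). If 2·|m₁·e₂ + ⟨D₂, ε₁⟩| < w and 2·|w·m₁·m₂ + m₁·e₂ + ⟨D₂, ε₁⟩| < q, then the product ciphertext u = D₂ᵀ·M₁ ∈ (ZMod q)^(N+1) decrypts to the product: Dec(u) := ⌈ valMinAbs(⟨u, s̄⟩) / w ⌋ = m₁·m₂. -/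
open Matrix

theorem ZMod.valMinAbs_intCast_of_two_mul_abs_lt {n : ℕ} [NeZero n] {x : ℤ}
    (hx : 2 * |x| < n) : (x : ZMod n).valMinAbs = x := by
  rw [ZMod.valMinAbs_spec]
  have := neg_abs_le x
  have := le_abs_self x
  exact ⟨rfl, by linarith, by linarith⟩

theorem round_mul_add_div_of_two_mul_abs_lt {w : ℕ} {m e : ℤ} (he : 2 * |e| < w) :
    round ((((w : ℤ) * m + e : ℤ) : ℚ) / (w : ℚ)) = m := by
  have hw : (0 : ℚ) < w := by
    have : (0 : ℤ) < w := lt_of_le_of_lt (by positivity) he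
    exact_mod_cast this
  have he' : 2 * |(e : ℚ)| < w := by exact_mod_cast he
  have := neg_abs_le (e : ℚ)
  have := le_abs_self (e : ℚ)
  rw [round_eq_iff, Set.mem_Ico, le_div_iff₀ hw, div_lt_iff₀ hw]
  push_cast
  constructor <;> linarith

/-- The phase of a product ciphertext, for any decomposition `d` of `c` along the rows of `R`. -/
theorem vecMul_dotProduct_eq_of_mulVec_eq {S m n : Type*} [CommRing S] [Fintype m] [Fintype n]
    {M R : Matrix m n S} {t : n → S} {μ : S} {ε d : m → S} {c : n → S}
    (hM : M.mulVec t = fun i => μ * R.mulVec t i + ε i) (hd : Matrix.vecMul d R = c) :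
    Matrix.vecMul d M ⬝ᵥ t = μ * (c ⬝ᵥ t) + d ⬝ᵥ ε := by
  have h : (fun i => μ * R.mulVec t i + ε i) = μ • R.mulVec t + ε := rfl
  rw [← Matrix.dotProduct_mulVec, hM, h, dotProduct_add, dotProduct_smul, smul_eq_mul,
    Matrix.dotProduct_mulVec, hd]

/-- Multiplicative homomorphism of FHE-LWE: with `q = w·a = 10^L`, an `Enc2`-ciphertext `M₁`
of `m₁` (i.e. `M₁·s̄ = m₁·(R·s̄) + ε₁` with `R = col(10⁰,…,10^(L−1)) ⊗ I_(N+1)`), an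
`Enc`-ciphertext `c₂` of `m₂` with injected error `e₂`, and a base-10 digit decomposition `D₂`
of `c₂` (entries in `{0,…,9}` and `D₂ᵀ·R = c₂`), the product ciphertext `u = D₂ᵀ·M₁` decrypts
to `m₁·m₂`, provided `2|m₁e₂ + ⟨D₂, ε₁⟩| < w` and `2|w·m₁·m₂ + m₁e₂ + ⟨D₂, ε₁⟩| < q`. -/
theorem lwe_mul_homomorphic (w a N L : ℕ) (hw : 0 < w) (ha : 0 < a) (hN : 0 < N) (hL : 0 < L)
    (hq : w * a = 10 ^ L)
    (s : Fin N → ZMod (w * a)) (m₁ m₂ e₂ : ℤ)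
    (ε₁ : Fin L × Fin (N + 1) → ℤ)
    (M₁ : Matrix (Fin L × Fin (N + 1)) (Fin (N + 1)) (ZMod (w * a)))
    (R : Matrix (Fin L × Fin (N + 1)) (Fin (N + 1)) (ZMod (w * a)))
    (hR : ∀ (i : Fin L × Fin (N + 1)) (j : Fin (N + 1)),
      R i j = if i.2 = j then (10 : ZMod (w * a)) ^ (i.1 : ℕ) else 0)
    (hM₁ : M₁.mulVec (Fin.cons 1 s) =
      fun i => (m₁ : ZMod (w * a)) * R.mulVec (Fin.cons 1 s) i + (ε₁ i : ZMod (w * a)))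
    (c₂ : Fin (N + 1) → ZMod (w * a))
    (hc₂ : c₂ ⬝ᵥ Fin.cons 1 s = (((w : ℤ) * m₂ + e₂ : ℤ) : ZMod (w * a)))
    (D₂ : Fin L × Fin (N + 1) → ℤ)
    (hD₂ : ∀ i, 0 ≤ D₂ i ∧ D₂ i ≤ 9)
    (hdec : Matrix.vecMul (fun i => (D₂ i : ZMod (w * a))) R = c₂)
    (herr : 2 * |m₁ * e₂ + D₂ ⬝ᵥ ε₁| < (w : ℤ))
    (herr2 : 2 * |(w : ℤ) * m₁ * m₂ + m₁ * e₂ + D₂ ⬝ᵥ ε₁| < (w : ℤ) * (a : ℤ)) :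
    lweDec w (w * a) s (Matrix.vecMul (fun i => (D₂ i : ZMod (w * a))) M₁) = m₁ * m₂ := by
  have : NeZero (w * a) := ⟨by positivity⟩
  have hcast : (fun i => (D₂ i : ZMod (w * a))) ⬝ᵥ (fun i => (ε₁ i : ZMod (w * a))) =
      ((D₂ ⬝ᵥ ε₁ : ℤ) : ZMod (w * a)) := by
    simp [dotProduct]
  have hphase : Matrix.vecMul (fun i => (D₂ i : ZMod (w * a))) M₁ ⬝ᵥ Fin.cons 1 s =
      (((w : ℤ) * (m₁ * m₂) + (m₁ * e₂ + D₂ ⬝ᵥ ε₁) : ℤ) : ZMod (w * a)) := by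
    rw [vecMul_dotProduct_eq_of_mulVec_eq hM₁ hdec, hc₂, hcast]
    push_cast
    ring
  have hsmall : 2 * |(w : ℤ) * (m₁ * m₂) + (m₁ * e₂ + D₂ ⬝ᵥ ε₁)| < ((w * a : ℕ) : ℤ) := by
    rw [← mul_assoc, ← add_assoc]
    exact_mod_cast herr2
  rw [lweDec, hphase, ZMod.valMinAbs_intCast_of_two_mul_abs_lt hsmall,
    round_mul_add_div_of_two_mul_abs_lt herr]
end
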